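/- arXiv:1011.2433 — 10 statements merged into one kernel-verified Lean document; each statement's English description precedes it below -/
import Mathlib

section
/- Let H be an n×n nonsingular complex Hankel matrix with entries H_{ij} = h_{i+j-1} (indices 1 ≤ i,j ≤ n) determined by a sequence h_1, ..., h_{2n-1}. Let a = (a_0, ..., a_{n-1})^T be the solution of H a = e_n (where e_n is the n-th standard basis vector) and let b = (b_0, ..., b_{n-1})^T be the solution of H b = (h_{n+1}, ..., h_{2n-1}, 0)^T. Then a_0 ≠ 0 or b_0 ≠ 0. -/
open Matrix

/-- If `v 0 = 0`, shifting `v` by one place shifts its image under a Hankel matrix. -/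
lemma hankel_mulVec_shift {R : Type*} [CommSemiring R] {m : ℕ} {h : ℕ → R}
    {H : Matrix (Fin (m + 1)) (Fin (m + 1)) R}
    (hH : ∀ i j, H i j = h ((i : ℕ) + (j : ℕ) + 1)) {v : Fin (m + 1) → R} (hv : v 0 = 0)
    (i : Fin m) :
    (H *ᵥ (Fin.snoc (Fin.tail v) 0 : Fin (m + 1) → R)) i.succ = (H *ᵥ v) i.castSucc := by
  simp only [mulVec, dotProduct]
  rw [Fin.sum_univ_castSucc, Fin.sum_univ_succ (fun j => H i.castSucc j * v j)]
  simp only [Fin.snoc_castSucc, Fin.snoc_last, hv, mul_zero, add_zero, zero_add, hH, Fin.tail]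
  refine Finset.sum_congr rfl fun j _ => ?_
  congr 2
  simp only [Fin.val_succ, Fin.val_castSucc]
  ring

/-- Let `H` be an `n×n` nonsingular complex Hankel matrix with entries
`H i j = h (i+j+1)` (0-based indices, 1-based sequence `h`).  Let `a` solve `H a = e_n`
and `b` solve `H b = (h_{n+1}, ..., h_{2n-1}, 0)ᵀ`.  Then `a 0 ≠ 0` or `b 0 ≠ 0`. -/
theorem hankel_first_coeffs_not_both_zero
    (n : ℕ) (hn : 0 < n) (h : ℕ → ℂ)
    (H : Matrix (Fin n) (Fin n) ℂ)
    (hH : ∀ i j : Fin n, H i j = h ((i : ℕ) + (j : ℕ) + 1))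
    (hdet : IsUnit H.det)
    (a b : Fin n → ℂ)
    (ha : H *ᵥ a = fun j : Fin n => if (j : ℕ) = n - 1 then 1 else 0)
    (hb : H *ᵥ b = fun j : Fin n => if (j : ℕ) = n - 1 then 0 else h (n + 1 + (j : ℕ))) :
    a ⟨0, hn⟩ ≠ 0 ∨ b ⟨0, hn⟩ ≠ 0 := by
  obtain _ | m := n
  · exact absurd hn (lt_irrefl 0)
  by_contra! hab
  obtain ⟨ha0, hb0⟩ := hab
  have hinj := mulVec_injective_iff_isUnit.2 ((isUnit_iff_isUnit_det H).2 hdet)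
  have hker : ∀ v, H *ᵥ v = 0 → v = 0 := fun v hv => hinj (hv.trans (mulVec_zero H).symm)
  set a' : Fin (m + 1) → ℂ := Fin.snoc (Fin.tail a) 0 with ha'
  set b' : Fin (m + 1) → ℂ := Fin.snoc (Fin.tail b) 0 with hb'
  set w : Fin (m + 1) → ℂ := b' - Pi.single (Fin.last m) 1 with hw
  have hHa (i : Fin m) : (H *ᵥ a') i.succ = 0 := by
    rw [ha', hankel_mulVec_shift hH ha0, ha]
    simp [i.isLt.ne]
  have hHw (i : Fin m) : (H *ᵥ w) i.succ = 0 := by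
    rw [hw, mulVec_sub, Pi.sub_apply, hb', hankel_mulVec_shift hH hb0, hb,
      mulVec_single_one, col_apply, hH]
    simp only [Fin.val_castSucc, Fin.val_succ, Fin.val_last, Nat.add_sub_cancel, i.isLt.ne,
      if_false]
    rw [sub_eq_zero]
    congr 1
    ring
  have hc : (H *ᵥ a') 0 ≠ 0 := by
    intro h0
    have ha'0 : a' = 0 := hker _ (funext (Fin.cases h0 hHa))
    have haz : a = 0 := by
      refine funext (Fin.cases ha0 fun i => ?_)
      simpa [ha', Fin.tail] using congrFun ha'0 i.castSucc
    simpa [haz] using congrFun ha (Fin.last m)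
  have hz : (H *ᵥ a') 0 • w - (H *ᵥ w) 0 • a' = 0 := by
    refine hker _ (funext (Fin.cases ?_ fun i => ?_))
    · simp [mulVec_sub, mulVec_smul, mul_comm]
    · simp [mulVec_sub, mulVec_smul, hHa, hHw]
  have hlast := congrFun hz (Fin.last m)
  simp [hw, ha', hb'] at hlast
  exact hc hlast
end

section
/- Let H_γ^κ be an (n+1)×(n+1) complex Hankel matrix whose entries along the skew-diagonals are h_1, ..., h_{2n-1}, γ, κ (i.e., (H_γ^κ)_{ij} = h_{i+j-1} for i+j-1 ≤ 2n-1, (H_γ^κ)_{ij} = γ for i+j-1 = 2n, and (H_γ^κ)_{n+1,n+1} = κ). Suppose the leading n×n principal submatrix H = H_γ^κ(1:n,1:n) is nonsingular and that κ ≠ (h_{n+1}, ..., h_{2n-1}, γ) H^{-1} (h_{n+1}, ..., h_{2n-1}, γ)^T, so that H_γ^κ is nonsingular. Let p = (p_0, ..., p_n)^T be the solution of H_γ^κ x = e_{n+1}. Then there is at most one complex number γ for which p_0 = 0; for every other γ, p_0 ≠ 0. -/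
open Matrix

/-- A solution `w` of `H w = e₀` for a nonsingular Hankel matrix `H` cannot both have a vanishing
last entry and annihilate the next window of Hankel entries. -/
lemma hankel_window_ne_zero {m : ℕ} {h : ℕ → ℂ} {H : Matrix (Fin (m + 1)) (Fin (m + 1)) ℂ}
    (hH : ∀ i j, H i j = h ((i : ℕ) + (j : ℕ) + 1)) (hdet : IsUnit H.det)
    {w : Fin (m + 1) → ℂ} (hw : H *ᵥ w = Pi.single 0 1) (hlast : w (Fin.last m) = 0) :
    ∑ j : Fin m, w j.castSucc * h (m + 2 + j) ≠ 0 := by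
  intro hsum
  have hinj := mulVec_injective_of_isUnit ((isUnit_iff_isUnit_det H).2 hdet)
  have hshift : (Fin.cons 0 (fun j : Fin m => w j.castSucc) : Fin (m + 1) → ℂ) = 0 := by
    apply hinj
    rw [mulVec_zero]
    funext i
    simp only [mulVec, dotProduct, Fin.sum_univ_succ, Fin.cons_zero, Fin.cons_succ, mul_zero,
      zero_add, hH, Pi.zero_apply, Fin.val_succ]
    refine Fin.lastCases ?_ (fun i => ?_) i
    · rw [← hsum]
      refine Finset.sum_congr rfl fun j _ => ?_
      rw [mul_comm, Fin.val_last, show m + ((j : ℕ) + 1) + 1 = m + 2 + j by ring]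
    · have hi := congrFun hw i.succ
      simp only [mulVec, dotProduct, Fin.sum_univ_castSucc, hlast, mul_zero, add_zero, hH,
        Fin.val_succ, Fin.val_castSucc] at hi
      rw [Pi.single_eq_of_ne (Fin.succ_ne_zero i)] at hi
      rw [← hi]
      refine Finset.sum_congr rfl fun j _ => ?_
      rw [Fin.val_castSucc, show (i : ℕ) + ((j : ℕ) + 1) + 1 = i + 1 + j + 1 by ring]
  have hw0 : w = 0 := by
    funext i
    refine Fin.lastCases hlast (fun j => ?_) i
    simpa using congrFun hshift j.succ
  simpa [hw0] using congrFun hw 0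

/-- A solution of the bordered system `[H v; * *] p = e_last` with `p 0 = 0` yields, after
normalising the last entry, a solution `q` of `H q = -v` with `q 0 = 0`. -/
lemma exists_mulVec_eq_neg_of_bordered {m : ℕ} {H : Matrix (Fin (m + 1)) (Fin (m + 1)) ℂ}
    (hdet : IsUnit H.det) {M : Matrix (Fin (m + 2)) (Fin (m + 2)) ℂ} {v : Fin (m + 1) → ℂ}
    (hMH : ∀ i j : Fin (m + 1), M i.castSucc j.castSucc = H i j)
    (hMv : ∀ i : Fin (m + 1), M i.castSucc (Fin.last (m + 1)) = v i)
    {p : Fin (m + 2) → ℂ} (hp : ∀ i : Fin (m + 1), (M *ᵥ p) i.castSucc = 0)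
    (hp_ne : p ≠ 0) (hp0 : p 0 = 0) :
    ∃ q : Fin (m + 1) → ℂ, H *ᵥ q = -v ∧ q 0 = 0 := by
  set a := p (Fin.last (m + 1))
  set u : Fin (m + 1) → ℂ := fun j => p j.castSucc with hu
  have hHu : H *ᵥ u = -(a • v) := by
    funext i
    have hi := hp i
    rw [mulVec, dotProduct, Fin.sum_univ_castSucc] at hi
    simp only [hMH, hMv] at hi
    simp only [mulVec, dotProduct, Pi.neg_apply, Pi.smul_apply, smul_eq_mul, hu]
    linear_combination hi
  have ha0 : a ≠ 0 := by
    intro h0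
    have hu0 : u = 0 := by
      apply mulVec_injective_of_isUnit ((isUnit_iff_isUnit_det H).2 hdet)
      simp [hHu, h0]
    exact hp_ne (funext fun i => Fin.lastCases h0 (fun j => congrFun hu0 j) i)
  refine ⟨a⁻¹ • u, ?_, ?_⟩
  · rw [mulVec_smul, hHu, smul_neg, inv_smul_smul₀ ha0]
  · simp [hu, hp0]

/-- Let `H_γ^κ` be the `(n+1)×(n+1)` complex Hankel matrix with skew-diagonal
entries `h_1, ..., h_{2n-1}, γ, κ`, whose leading `n×n` principal submatrix `H` is nonsingular,
and suppose `κ ≠ (h_{n+1},...,h_{2n-1},γ) H⁻¹ (h_{n+1},...,h_{2n-1},γ)ᵀ` (so `H_γ^κ` is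
nonsingular).  If `p` solves `H_γ^κ p = e_{n+1}`, then there is at most one `γ ∈ ℂ` for which
`p 0 = 0`. -/
theorem at_most_one_gamma_with_p0_zero
    (n : ℕ) (hn : 0 < n) (h : ℕ → ℂ)
    (H : Matrix (Fin n) (Fin n) ℂ)
    (hH : ∀ i j : Fin n, H i j = h ((i : ℕ) + (j : ℕ) + 1))
    (hdet : IsUnit H.det) :
    {γ : ℂ | ∃ κ : ℂ,
      κ ≠ (fun j : Fin n => if (j : ℕ) = n - 1 then γ else h (n + 1 + (j : ℕ))) ⬝ᵥ
            (H⁻¹ *ᵥ fun j : Fin n => if (j : ℕ) = n - 1 then γ else h (n + 1 + (j : ℕ))) ∧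
      ∃ p : Fin (n + 1) → ℂ,
        ((Matrix.of fun i j : Fin (n + 1) =>
            if (i : ℕ) + (j : ℕ) < 2 * n - 1 then h ((i : ℕ) + (j : ℕ) + 1)
            else if (i : ℕ) + (j : ℕ) = 2 * n - 1 then γ else κ) *ᵥ p =
          fun j : Fin (n + 1) => if (j : ℕ) = n then 1 else 0) ∧
        p 0 = 0}.Subsingleton := by
  obtain ⟨m, rfl⟩ : ∃ m, n = m + 1 := ⟨n - 1, by omega⟩
  let v (γ : ℂ) (j : Fin (m + 1)) : ℂ := if (j : ℕ) = m then γ else h (m + 2 + j)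
  have hv_last (γ : ℂ) : v γ (Fin.last m) = γ := by simp [v]
  have hv_castSucc (γ : ℂ) (j : Fin m) : v γ j.castSucc = h (m + 2 + j) := by
    simp [v, j.isLt.ne]
  have hHT : Hᵀ = H := by
    ext i j
    rw [transpose_apply, hH, hH, add_comm (j : ℕ)]
  obtain ⟨w, hw⟩ : ∃ w, H *ᵥ w = Pi.single 0 1 :=
    ⟨H⁻¹ *ᵥ Pi.single 0 1, by rw [mulVec_mulVec, mul_nonsing_inv _ hdet, one_mulVec]⟩
  have hannihilate (γ : ℂ) (hγ : ∃ q, H *ᵥ q = -v γ ∧ q 0 = 0) :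
      ∑ j : Fin m, w j.castSucc * h (m + 2 + j) + w (Fin.last m) * γ = 0 := by
    obtain ⟨q, hq, hq0⟩ := hγ
    have hwv : w ⬝ᵥ v γ = 0 := by
      rw [← neg_eq_zero, ← dotProduct_neg, ← hq, dotProduct_mulVec, ← mulVec_transpose, hHT, hw,
        single_one_dotProduct, hq0]
    simpa only [dotProduct, Fin.sum_univ_castSucc, hv_last, hv_castSucc] using hwv
  have hwindow (γ : ℂ) (κ : ℂ) (p : Fin (m + 2) → ℂ)
      (hp : (Matrix.of fun i j : Fin (m + 2) =>
          if (i : ℕ) + (j : ℕ) < 2 * (m + 1) - 1 then h ((i : ℕ) + (j : ℕ) + 1)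
          else if (i : ℕ) + (j : ℕ) = 2 * (m + 1) - 1 then γ else κ) *ᵥ p =
        fun j : Fin (m + 2) => if (j : ℕ) = m + 1 then 1 else 0) (hp0 : p 0 = 0) :
      ∑ j : Fin m, w j.castSucc * h (m + 2 + j) + w (Fin.last m) * γ = 0 := by
    refine hannihilate γ (exists_mulVec_eq_neg_of_bordered hdet ?_ ?_ (fun i => ?_) ?_ hp0
      (M := Matrix.of fun i j : Fin (m + 2) =>
          if (i : ℕ) + (j : ℕ) < 2 * (m + 1) - 1 then h ((i : ℕ) + (j : ℕ) + 1)
          else if (i : ℕ) + (j : ℕ) = 2 * (m + 1) - 1 then γ else κ))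
    · intro i j
      have hlt : (i : ℕ) + j < 2 * (m + 1) - 1 := by omega
      simp only [of_apply, Fin.val_castSucc, if_pos hlt, hH]
    · intro i
      simp only [of_apply, Fin.val_castSucc, Fin.val_last, v]
      have hi := i.isLt
      by_cases him : (i : ℕ) = m
      · rw [if_neg (by omega), if_pos (by omega), if_pos him]
      · rw [if_pos (by omega), if_neg him, show (i : ℕ) + (m + 1) + 1 = m + 2 + i by ring]
    · rw [hp]
      simp [i.isLt.ne]
    · rintro rfl
      simpa using congrFun hp (Fin.last (m + 1))
  rintro γ₁ ⟨κ₁, -, p₁, hp₁, hp₁0⟩ γ₂ ⟨κ₂, -, p₂, hp₂, hp₂0⟩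
  have h₁ := hwindow γ₁ κ₁ p₁ hp₁ hp₁0
  have h₂ := hwindow γ₂ κ₂ p₂ hp₂ hp₂0
  have hlast : w (Fin.last m) ≠ 0 := fun h0 =>
    hankel_window_ne_zero hH hdet hw h0 (by simpa [h0] using h₁)
  exact mul_left_cancel₀ hlast (by linear_combination h₁ - h₂)
end

section
/- For all complex numbers α and β, the generalized lower triangular Pascal matrices satisfy P_n[α] · P_n[β] = P_n[α + β]. -/
open Matrix

/-- The `n×n` generalized lower triangular Pascal matrix `P_n[α]`:
`(P_n[α])_{ij} = α^(i-j) * C(i-1, j-1)` for `i ≥ j` (1-based), i.e. `α^(i-j) * C(i,j)`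
for 0-based indices, and `0` otherwise. -/
def genPascal (n : ℕ) (α : ℂ) : Matrix (Fin n) (Fin n) ℂ :=
  Matrix.of fun i j : Fin n =>
    if (j : ℕ) ≤ (i : ℕ) then α ^ ((i : ℕ) - (j : ℕ)) * ((i : ℕ).choose (j : ℕ) : ℂ) else 0

/-- The case distinction in `genPascal` is redundant, since `Nat.choose` vanishes above the
diagonal. -/
lemma genPascal_apply (n : ℕ) (α : ℂ) (i j : Fin n) :
    genPascal n α i j = α ^ ((i : ℕ) - (j : ℕ)) * ((i : ℕ).choose (j : ℕ) : ℂ) := by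
  rw [genPascal, Matrix.of_apply]
  split_ifs with h
  · rfl
  · rw [Nat.choose_eq_zero_of_lt (not_le.mp h), Nat.cast_zero, mul_zero]

/-- The binomial theorem, multiplied by a binomial coefficient and summed over an interval. -/
lemma sum_Ico_pow_mul_choose_mul_pow_mul_choose {R : Type*} [CommSemiring R] (x y : R) (i j : ℕ) :
    ∑ k ∈ Finset.Ico j (i + 1), x ^ (i - k) * (i.choose k : R) * (y ^ (k - j) * (k.choose j : R)) =
      (x + y) ^ (i - j) * (i.choose j : R) := by
  rcases lt_or_ge i j with h | h
  · rw [Finset.Ico_eq_empty (by omega), Finset.sum_empty, Nat.choose_eq_zero_of_lt h,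
      Nat.cast_zero, mul_zero]
  · rw [Finset.sum_Ico_eq_sum_range, add_comm x y, add_pow, Finset.sum_mul,
      Nat.sub_add_comm h]
    refine Finset.sum_congr rfl fun k _ => ?_
    have hc : (i.choose (j + k) : R) * ((j + k).choose j : R) =
        (i.choose j : R) * ((i - j).choose k : R) := by
      have := Nat.choose_mul (n := i) (Nat.le_add_right j k)
      rw [Nat.add_sub_cancel_left] at this
      exact_mod_cast congrArg (Nat.cast (R := R)) this
    rw [Nat.add_sub_cancel_left, Nat.sub_add_eq]
    calc _ = y ^ k * x ^ (i - j - k) * ((i.choose (j + k) : R) * ((j + k).choose j : R)) := by ring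
      _ = _ := by rw [hc]; ring

/-- `P_n[α] · P_n[β] = P_n[α + β]` for all complex `α`, `β`. -/
theorem genPascal_mul (n : ℕ) (α β : ℂ) :
    genPascal n α * genPascal n β = genPascal n (α + β) := by
  ext i j
  simp only [Matrix.mul_apply, genPascal_apply]
  rw [Fin.sum_univ_eq_sum_range (fun k => α ^ ((i : ℕ) - k) * ((i : ℕ).choose k : ℂ) *
      (β ^ (k - (j : ℕ)) * (k.choose (j : ℕ) : ℂ))) n,
    ← sum_Ico_pow_mul_choose_mul_pow_mul_choose]
  symm
  apply Finset.sum_subset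
  · intro k hk
    simp only [Finset.mem_Ico, Finset.mem_range] at hk ⊢
    omega
  · intro k _ hk
    rw [Finset.mem_Ico, not_and_or, not_le, not_lt] at hk
    rcases hk with hk | hk
    · simp [Nat.choose_eq_zero_of_lt hk]
    · simp [Nat.choose_eq_zero_of_lt (Nat.lt_of_succ_le hk)]
end

section
/- For every s ∈ [0,1], the n×n Bernstein matrix satisfies B_n^e(s) = P_n · G_n(s) · P_n^{-1}, where P_n is the n×n lower triangular Pascal matrix and G_n(s) = diag(1, s, s^2, ..., s^{n-1}). -/
open Matrix

/-- The `n×n` Bernstein matrix `B_n^e(s)`: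
`[B_n^e(s)]_{ij} = C(i-1, j-1) s^(j-1) (1-s)^(i-j)` for `i ≥ j` (1-based) and `0` otherwise. -/
def bernsteinMat (n : ℕ) (s : ℝ) : Matrix (Fin n) (Fin n) ℝ :=
  Matrix.of fun i j : Fin n =>
    if (j : ℕ) ≤ (i : ℕ) then
      ((i : ℕ).choose (j : ℕ) : ℝ) * s ^ (j : ℕ) * (1 - s) ^ ((i : ℕ) - (j : ℕ))
    else 0

/-- The `n×n` lower triangular Pascal matrix. -/
def pascal (n : ℕ) : Matrix (Fin n) (Fin n) ℝ :=
  Matrix.of fun i j : Fin n =>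
    if (j : ℕ) ≤ (i : ℕ) then ((i : ℕ).choose (j : ℕ) : ℝ) else 0

theorem bernsteinMat_apply (n : ℕ) (s : ℝ) (i j : Fin n) :
    bernsteinMat n s i j =
      ((i : ℕ).choose j : ℝ) * s ^ (j : ℕ) * (1 - s) ^ ((i : ℕ) - (j : ℕ)) := by
  simp only [bernsteinMat, of_apply]
  split_ifs with h
  · rfl
  · simp [Nat.choose_eq_zero_of_lt (not_le.mp h)]

theorem pascal_apply (n : ℕ) (i j : Fin n) : pascal n i j = ((i : ℕ).choose j : ℝ) := by
  simp only [pascal, of_apply]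
  split_ifs with h
  · rfl
  · simp [Nat.choose_eq_zero_of_lt (not_le.mp h)]

theorem det_pascal (n : ℕ) : (pascal n).det = 1 := by
  rw [det_of_isLowerTriangular]
  · simp [pascal_apply]
  · intro i j hij
    rw [pascal_apply, Nat.choose_eq_zero_of_lt, Nat.cast_zero]
    exact hij

/-- The `j`-th factorial moment of the binomial distribution, divided by `j!`. -/
theorem sum_choose_mul_pow_mul_choose {R : Type*} [CommRing R] {n i : ℕ} (j : ℕ) (hi : i < n)
    (s : R) :
    ∑ k ∈ Finset.range n, (i.choose k * s ^ k * (1 - s) ^ (i - k) * k.choose j : R) =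
      i.choose j * s ^ j := by
  have hrange : ∑ k ∈ Finset.range n, (i.choose k * s ^ k * (1 - s) ^ (i - k) * k.choose j : R) =
      ∑ k ∈ Finset.range (i + 1), (i.choose k * s ^ k * (1 - s) ^ (i - k) * k.choose j : R) := by
    refine (Finset.sum_subset (Finset.range_subset_range.mpr hi) fun k _ hk => ?_).symm
    have hik : i < k := by simpa using hk
    simp [Nat.choose_eq_zero_of_lt hik]
  rw [hrange]
  obtain hij | hji := lt_or_ge i j
  · rw [Nat.choose_eq_zero_of_lt hij, Nat.cast_zero, zero_mul]
    refine Finset.sum_eq_zero fun k hk => ?_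
    have hkj : k < j := by grind
    simp [Nat.choose_eq_zero_of_lt hkj]
  · obtain ⟨d, rfl⟩ := Nat.exists_eq_add_of_le hji
    have hlow : ∑ k ∈ Finset.range j,
        ((j + d).choose k * s ^ k * (1 - s) ^ (j + d - k) * k.choose j : R) = 0 :=
      Finset.sum_eq_zero fun k hk => by
        simp [Nat.choose_eq_zero_of_lt (Finset.mem_range.mp hk)]
    have hbinom : ((j + d).choose j : R) * s ^ j = (j + d).choose j * s ^ j *
        ∑ x ∈ Finset.range (d + 1), s ^ x * (1 - s) ^ (d - x) * d.choose x := by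
      rw [← add_pow, add_sub_cancel, one_pow, mul_one]
    rw [add_assoc, Finset.sum_range_add, hlow, zero_add, hbinom, Finset.mul_sum]
    refine Finset.sum_congr rfl fun x _ => ?_
    have hchoose : ((j + d).choose (j + x) * (j + x).choose j : R) =
        (j + d).choose j * d.choose x := by
      have h := Nat.choose_mul (n := j + d) (Nat.le_add_right j x)
      rw [Nat.add_sub_cancel_left, Nat.add_sub_cancel_left] at h
      simpa only [Nat.cast_mul] using congrArg (Nat.cast : ℕ → R) h
    rw [Nat.add_sub_add_left]
    linear_combination (s ^ (j + x) * (1 - s) ^ (d - x)) * hchoose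

theorem bernsteinMat_mul_pascal (n : ℕ) (s : ℝ) :
    bernsteinMat n s * pascal n = pascal n * diagonal (fun k : Fin n => s ^ (k : ℕ)) := by
  ext i j
  rw [mul_diagonal, mul_apply]
  simp only [bernsteinMat_apply, pascal_apply]
  rw [← sum_choose_mul_pow_mul_choose (j : ℕ) i.isLt s, Finset.sum_range]

/-- For `s ∈ [0,1]`, `B_n^e(s) = P_n · G_n(s) · P_n⁻¹`. -/
theorem bernstein_eq_pascal_diag_pascal_inv (n : ℕ) (s : ℝ) (hs : s ∈ Set.Icc (0 : ℝ) 1) :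
    bernsteinMat n s = pascal n * Matrix.diagonal (fun k : Fin n => s ^ (k : ℕ)) * (pascal n)⁻¹ := by
  rw [← bernsteinMat_mul_pascal, mul_nonsing_inv_cancel_right]
  simp [det_pascal]
end

section
/- Let H be an n×n complex Hankel matrix and let α be any complex number. Then P_n[α] · H · P_n[α]^T is again a Hankel matrix. -/
open Matrix

open Polynomial in
theorem sum_genPascal_smul_X_pow {n : ℕ} (α : ℂ) (i : Fin n) :
    ∑ a : Fin n, genPascal n α i a • (X : ℂ[X]) ^ (a : ℕ) = (X + C α) ^ (i : ℕ) := by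
  have h : ∀ a : Fin n, genPascal n α i a • (X : ℂ[X]) ^ (a : ℕ) =
      (fun m : ℕ => (α ^ ((i : ℕ) - m) * ((i : ℕ).choose m : ℂ)) • (X : ℂ[X]) ^ m) a := by
    intro a
    simp only [genPascal, Matrix.of_apply]
    split_ifs with ha
    · rfl
    · simp [Nat.choose_eq_zero_of_lt (not_le.mp ha)]
  rw [Finset.sum_congr rfl fun a _ => h a, Fin.sum_univ_eq_sum_range
    (fun m : ℕ => (α ^ ((i : ℕ) - m) * ((i : ℕ).choose m : ℂ)) • (X : ℂ[X]) ^ m), add_pow]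
  symm
  apply Finset.sum_subset_zero_on_sdiff
  · exact Finset.range_subset_range.mpr i.isLt
  · intro m hm
    have hm' : (i : ℕ) < m := by
      simp only [Finset.mem_sdiff, Finset.mem_range] at hm
      omega
    simp [Nat.choose_eq_zero_of_lt hm']
  · intro m _
    simp only [smul_eq_C_mul, map_mul, map_pow, map_natCast]
    ring

open Polynomial in
/-- A linear functional on polynomials whose moments are the entries of `H` turns the entries of
`P_n[α] * H * P_n[α]ᵀ` into the moments of powers of `X + α`. -/
theorem genPascal_mul_mul_transpose_apply {n : ℕ} (α : ℂ) (H : Matrix (Fin n) (Fin n) ℂ)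
    (L : ℂ[X] →ₗ[ℂ] ℂ) (hL : ∀ a b : Fin n, L (X ^ ((a : ℕ) + (b : ℕ))) = H a b) (i j : Fin n) :
    (genPascal n α * H * (genPascal n α)ᵀ) i j = L ((X + C α) ^ ((i : ℕ) + (j : ℕ))) := by
  rw [pow_add, ← sum_genPascal_smul_X_pow, ← sum_genPascal_smul_X_pow, Finset.sum_mul_sum,
    Finset.sum_comm]
  simp only [Matrix.mul_apply, Matrix.transpose_apply, map_sum, Finset.sum_mul,
    smul_mul_smul_comm, ← pow_add, map_smul, hL, smul_eq_mul]
  refine Finset.sum_congr rfl fun b _ => Finset.sum_congr rfl fun a _ => ?_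
  ring

/-- If `H` is an `n×n` complex Hankel matrix and `α ∈ ℂ`, then
`P_n[α] · H · P_n[α]ᵀ` is again a Hankel matrix. -/
theorem genPascal_mul_hankel_mul_genPascal_transpose_isHankel
    (n : ℕ) (α : ℂ) (H : Matrix (Fin n) (Fin n) ℂ)
    (hH : ∀ i j k l : Fin n, (i : ℕ) + (j : ℕ) = (k : ℕ) + (l : ℕ) → H i j = H k l) :
    ∀ i j k l : Fin n, (i : ℕ) + (j : ℕ) = (k : ℕ) + (l : ℕ) →
      (genPascal n α * H * (genPascal n α)ᵀ) i j =
        (genPascal n α * H * (genPascal n α)ᵀ) k l := by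
  classical
  let h : ℕ → ℂ := fun m =>
    if hm : ∃ p : Fin n × Fin n, (p.1 : ℕ) + (p.2 : ℕ) = m then H hm.choose.1 hm.choose.2 else 0
  let L : Polynomial ℂ →ₗ[ℂ] ℂ := (Polynomial.basisMonomials ℂ).constr ℂ h
  have hL : ∀ a b : Fin n, L (Polynomial.X ^ ((a : ℕ) + (b : ℕ))) = H a b := by
    intro a b
    have hm : ∃ p : Fin n × Fin n, (p.1 : ℕ) + (p.2 : ℕ) = (a : ℕ) + (b : ℕ) := ⟨(a, b), rfl⟩
    have hb : (Polynomial.X : Polynomial ℂ) ^ ((a : ℕ) + (b : ℕ)) =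
        Polynomial.basisMonomials ℂ ((a : ℕ) + (b : ℕ)) := by
      simp [Polynomial.X_pow_eq_monomial]
    rw [hb, Module.Basis.constr_basis]
    simp only [h, dif_pos hm]
    exact hH _ _ _ _ hm.choose_spec
  intro i j k l hijkl
  rw [genPascal_mul_mul_transpose_apply α H L hL, genPascal_mul_mul_transpose_apply α H L hL, hijkl]
end

section
/- Let H be an n×n nonsingular complex Hankel matrix with entries H_{ij} = h_{i+j-1} determined by h_1, ..., h_{2n-1}. Let a = (a_0, ..., a_{n-1})^T and b = (b_0, ..., b_{n-1})^T be the solutions of H a = e_n and H b = (h_{n+1}, ..., h_{2n-1}, 0)^T, respectively. Then the polynomials r(x) = x^n - b_{n-1} x^{n-1} - ... - b_1 x - b_0 and s(x) = a_{n-1} x^{n-1} + ... + a_1 x + a_0 have no common root in C. -/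
open Matrix

open Polynomial in
/-- The linear functional on polynomials whose moments are the sequence `g`. -/
noncomputable def momentFunctional (g : ℕ → ℂ) : ℂ[X] →ₗ[ℂ] ℂ :=
  Polynomial.lsum fun k => LinearMap.toSpanSingleton ℂ ℂ (g k)

open Polynomial in
theorem momentFunctional_C_mul_X_pow (g : ℕ → ℂ) (c : ℂ) (k : ℕ) :
    momentFunctional g (C c * X ^ k) = c * g k := by
  simp [momentFunctional, C_mul_X_pow_eq_monomial]

open Polynomial in
theorem momentFunctional_X_pow (g : ℕ → ℂ) (k : ℕ) :
    momentFunctional g (X ^ k) = g k := by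
  simpa using momentFunctional_C_mul_X_pow g 1 k

open Polynomial in
theorem linearMap_mul_eq_sum (L : ℂ[X] →ₗ[ℂ] ℂ) (p q : ℂ[X]) {m : ℕ} (hp : p.natDegree < m) :
    L (p * q) = ∑ i ∈ Finset.range m, p.coeff i * L (X ^ i * q) := by
  conv_lhs => rw [p.as_sum_range' m hp, Finset.sum_mul, map_sum]
  refine Finset.sum_congr rfl fun i _ => ?_
  rw [← C_mul_X_pow_eq_monomial, mul_assoc, ← smul_eq_C_mul, map_smul, smul_eq_mul]

open Polynomial in
theorem momentFunctional_X_pow_mul_sum (g : ℕ → ℂ) {n : ℕ} (c : Fin n → ℂ) (i : ℕ) :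
    momentFunctional g (X ^ i * ∑ k : Fin n, C (c k) * X ^ (k : ℕ)) =
      ∑ k : Fin n, g (i + k) * c k := by
  rw [Finset.mul_sum, map_sum]
  refine Finset.sum_congr rfl fun k _ => ?_
  rw [show (X ^ i * (C (c k) * X ^ (k : ℕ)) : ℂ[X]) = C (c k) * X ^ (i + (k : ℕ)) by ring,
    momentFunctional_C_mul_X_pow, mul_comm]

/-- Let `H` be an `n×n` nonsingular complex Hankel matrix with entries
`H i j = h (i+j+1)`.  Let `a` solve `H a = e_n` and `b` solve
`H b = (h_{n+1}, ..., h_{2n-1}, 0)ᵀ`.  Then the polynomials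
`r(x) = x^n - b_{n-1} x^{n-1} - ... - b_0` and `s(x) = a_{n-1} x^{n-1} + ... + a_0`
have no common root in `ℂ`. -/
theorem hankel_r_s_no_common_root
    (n : ℕ) (hn : 0 < n) (h : ℕ → ℂ)
    (H : Matrix (Fin n) (Fin n) ℂ)
    (hH : ∀ i j : Fin n, H i j = h ((i : ℕ) + (j : ℕ) + 1))
    (hdet : IsUnit H.det)
    (a b : Fin n → ℂ)
    (ha : H *ᵥ a = fun j : Fin n => if (j : ℕ) = n - 1 then 1 else 0)
    (hb : H *ᵥ b = fun j : Fin n => if (j : ℕ) = n - 1 then 0 else h (n + 1 + (j : ℕ))) :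
    ∀ z : ℂ, ¬ (z ^ n - ∑ k : Fin n, b k * z ^ (k : ℕ) = 0 ∧
                ∑ k : Fin n, a k * z ^ (k : ℕ) = 0) := by
  rintro z ⟨hr, hs⟩
  -- The moment `h (2 * n)`, which `H` does not involve, is set to zero.
  set g : ℕ → ℂ := fun k => if k = 2 * n - 1 then 0 else h (k + 1) with hg
  set L := momentFunctional g
  set s : Polynomial ℂ := ∑ k : Fin n, Polynomial.C (a k) * Polynomial.X ^ (k : ℕ) with hs_def
  set u : Polynomial ℂ := ∑ k : Fin n, Polynomial.C (b k) * Polynomial.X ^ (k : ℕ) with hu_def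
  have hgH (i k : Fin n) : g (i + k) = H i k := by
    rw [hH, hg]
    exact if_neg (by omega)
  have hLs (i : Fin n) : L (Polynomial.X ^ (i : ℕ) * s) = if (i : ℕ) = n - 1 then 1 else 0 := by
    rw [momentFunctional_X_pow_mul_sum, ← congrFun ha i]
    simp_rw [hgH]
    rfl
  have hLr (i : Fin n) : L (Polynomial.X ^ (i : ℕ) * (Polynomial.X ^ n - u)) = 0 := by
    have hLu : L (Polynomial.X ^ (i : ℕ) * u) = (H *ᵥ b) i := by
      rw [momentFunctional_X_pow_mul_sum]
      simp_rw [hgH]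
      rfl
    rw [mul_sub, map_sub, hLu, hb, ← pow_add, momentFunctional_X_pow, sub_eq_zero]
    have hi : (i : ℕ) + n = 2 * n - 1 ↔ (i : ℕ) = n - 1 := by omega
    simp only [hg, hi, show (i : ℕ) + n + 1 = n + 1 + i by ring]
  have hdeg_s : s.degree < n := Polynomial.degree_sum_fin_lt a
  have hdeg_u : u.degree < n := Polynomial.degree_sum_fin_lt b
  have hr_monic : (Polynomial.X ^ n - u).Monic := Polynomial.monic_X_pow_sub hdeg_u
  have hr_deg : (Polynomial.X ^ n - u).natDegree = n := by
    apply Polynomial.natDegree_eq_of_degree_eq_some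
    rw [Polynomial.degree_sub_eq_left_of_degree_lt] <;>
      simp [hdeg_u]
  obtain ⟨t, ht⟩ : Polynomial.X - Polynomial.C z ∣ s := by
    rw [Polynomial.dvd_iff_isRoot, Polynomial.IsRoot, hs_def, Polynomial.eval_finsetSum]
    simpa using hs
  obtain ⟨q, hq⟩ : Polynomial.X - Polynomial.C z ∣ Polynomial.X ^ n - u := by
    rw [Polynomial.dvd_iff_isRoot, Polynomial.IsRoot, hu_def, Polynomial.eval_sub,
      Polynomial.eval_finsetSum]
    simpa using hr
  have hq_monic : q.Monic := (Polynomial.monic_X_sub_C z).of_mul_monic_left (hq ▸ hr_monic)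
  have hq_deg : q.natDegree = n - 1 := by
    have := congrArg Polynomial.natDegree hq
    rw [hr_deg, (Polynomial.monic_X_sub_C z).natDegree_mul hq_monic,
      Polynomial.natDegree_X_sub_C] at this
    omega
  have ht_deg : t.natDegree < n := by
    rcases eq_or_ne t 0 with rfl | ht0
    · simp [hn]
    · have hs0 : s ≠ 0 := ht ▸ mul_ne_zero (Polynomial.X_sub_C_ne_zero z) ht0
      have h1 := (Polynomial.natDegree_lt_iff_degree_lt hs0).2 hdeg_s
      exact (Polynomial.natDegree_le_of_dvd (Dvd.intro_left _ ht.symm) hs0).trans_lt h1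
  have hzero : L (t * (Polynomial.X ^ n - u)) = 0 := by
    rw [linearMap_mul_eq_sum L _ _ ht_deg]
    refine Finset.sum_eq_zero fun i hi => ?_
    rw [hLr ⟨i, Finset.mem_range.1 hi⟩, mul_zero]
  have hone : L (q * s) = 1 := by
    rw [linearMap_mul_eq_sum L _ _ (show q.natDegree < n by omega), Finset.sum_eq_single (n - 1)]
    · rw [hLs ⟨n - 1, by omega⟩, if_pos rfl, mul_one, ← hq_deg]
      exact hq_monic
    · intro i hi hne
      rw [hLs ⟨i, Finset.mem_range.1 hi⟩, if_neg hne, mul_zero]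
    · intro hmem
      exact absurd (Finset.mem_range.2 (by omega)) hmem
  have heq : t * (Polynomial.X ^ n - u) = q * s := by
    rw [hq, ht]
    ring
  rw [heq, hone] at hzero
  exact one_ne_zero hzero
end

section
/- Let H be an n×n nonsingular complex Hankel matrix with entries H_{ij} = h_{i+j-1} determined by h_1, ..., h_{2n-1}. Let a and b solve H a = e_n and H b = (h_{n+1}, ..., h_{2n-1}, 0)^T, let r(x) = x^n - b_{n-1}x^{n-1} - ... - b_0 and s(x) = a_{n-1}x^{n-1} + ... + a_0, let S = { α ∈ C : (r s' - r' s)(α) = 0 and s(α) ≠ 0 } and T = { r(α)/s(α) : α ∈ S }. Then for every γ ∈ C \ T, the companion matrix C_γ with last row (b_0 + γ a_0, ..., b_{n-1} + γ a_{n-1}) has simple spectrum {α_1, ..., α_n}, and H = V D V^T, where V is the Vandermonde matrix with V e_i = (1, α_i, α_i^2, ..., α_i^{n-1})^T and D = diag(V^{-1} H e_1). -/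
open Matrix Polynomial

/-- The `n×n` companion matrix whose rows `1, ..., n-1` are `e_2ᵀ, ..., e_nᵀ` and whose
last row is `(c_0, ..., c_{n-1})`. -/
def companionMat (n : ℕ) (c : Fin n → ℂ) : Matrix (Fin n) (Fin n) ℂ :=
  Matrix.of fun i j : Fin n =>
    if (i : ℕ) < n - 1 then (if (j : ℕ) = (i : ℕ) + 1 then 1 else 0) else c j

/-- The polynomial `r(x) = x^n - b_{n-1} x^{n-1} - ... - b_1 x - b_0`. -/
noncomputable def rpoly (n : ℕ) (b : Fin n → ℂ) : Polynomial ℂ :=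
  X ^ n - ∑ k : Fin n, C (b k) * X ^ (k : ℕ)

/-- The polynomial `s(x) = a_{n-1} x^{n-1} + ... + a_1 x + a_0`. -/
noncomputable def spoly (n : ℕ) (a : Fin n → ℂ) : Polynomial ℂ :=
  ∑ k : Fin n, C (a k) * X ^ (k : ℕ)

/-- A companion matrix shifts a vector up and puts the combination with the last row at the
bottom. -/
theorem companionMat_mulVec (n : ℕ) (c u : Fin n → ℂ) (i : Fin n) :
    (companionMat n c *ᵥ u) i =
      if hi : (i : ℕ) + 1 < n then u ⟨i + 1, hi⟩ else c ⬝ᵥ u := by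
  by_cases hi : (i : ℕ) + 1 < n
  · have hi' : (i : ℕ) < n - 1 := by omega
    simp only [mulVec, dotProduct, companionMat, of_apply, hi', hi, if_true, dif_pos]
    rw [Finset.sum_eq_single ⟨i + 1, hi⟩]
    · simp
    · intro j _ hj
      have : (j : ℕ) ≠ i + 1 := fun e => hj (Fin.ext e)
      simp [this]
    · simp
  · have hi' : ¬ (i : ℕ) < n - 1 := by omega
    simp [mulVec, dotProduct, companionMat, hi', hi]

theorem companionMat_mul_apply (n : ℕ) (c : Fin n → ℂ) (M : Matrix (Fin n) (Fin n) ℂ)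
    (i j : Fin n) :
    (companionMat n c * M) i j =
      if hi : (i : ℕ) + 1 < n then M ⟨i + 1, hi⟩ j else c ⬝ᵥ fun k => M k j :=
  companionMat_mulVec n c (fun k => M k j) i

theorem mul_transpose_companionMat_apply (n : ℕ) (c : Fin n → ℂ)
    (M : Matrix (Fin n) (Fin n) ℂ) (i j : Fin n) :
    (M * (companionMat n c)ᵀ) i j =
      if hj : (j : ℕ) + 1 < n then M i ⟨j + 1, hj⟩ else c ⬝ᵥ M i := by
  rw [← transpose_apply (M * _), transpose_mul, transpose_transpose, companionMat_mul_apply]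
  rfl

/-- A matrix intertwining a companion matrix and its transpose is determined by its first
column. -/
theorem eq_of_companionMat_mul_eq_mul_transpose {n : ℕ} (hn : 0 < n) {c : Fin n → ℂ}
    {M N : Matrix (Fin n) (Fin n) ℂ}
    (hM : companionMat n c * M = M * (companionMat n c)ᵀ)
    (hN : companionMat n c * N = N * (companionMat n c)ᵀ)
    (h0 : ∀ i, M i ⟨0, hn⟩ = N i ⟨0, hn⟩) : M = N := by
  have key : ∀ (k : ℕ) (hk : k < n) (i : Fin n), M i ⟨k, hk⟩ = N i ⟨k, hk⟩ := by
    intro k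
    induction k with
    | zero => exact fun _ => h0
    | succ k ih =>
      intro hk i
      have e1 := congrFun (congrFun hM i) ⟨k, by omega⟩
      have e2 := congrFun (congrFun hN i) ⟨k, by omega⟩
      rw [companionMat_mul_apply, mul_transpose_companionMat_apply, dif_pos hk] at e1 e2
      rw [← e1, ← e2]
      simp only [ih]
  ext i j
  exact key j j.2 i

/-- A vector of the kernel of `Cᵀ - α`, for a companion matrix `C`, vanishes as soon as its last
coordinate does. -/
theorem eq_zero_of_transpose_companionMat_mulVec {n : ℕ} {c y : Fin n → ℂ} {α : ℂ}
    (hy : (companionMat n c)ᵀ *ᵥ y = α • y)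
    (hlast : ∀ i : Fin n, (i : ℕ) = n - 1 → y i = 0) : y = 0 := by
  have step : ∀ (i : ℕ) (hi : i + 1 < n), y ⟨i, by omega⟩ = α * y ⟨i + 1, hi⟩ := by
    intro i hi
    have e := congrFun hy ⟨i + 1, hi⟩
    rw [Pi.smul_apply, smul_eq_mul] at e
    rw [← e, mulVec, dotProduct, Finset.sum_eq_single ⟨i, by omega⟩]
    · have : i < n - 1 := by omega
      simp [companionMat, this]
    · intro k _ hk
      have hki : (k : ℕ) ≠ i := fun e => hk (Fin.ext e)
      by_cases hk' : (k : ℕ) < n - 1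
      · simp [companionMat, hk', hki.symm]
      · rw [hlast k (by omega), mul_zero]
    · simp
  have key : ∀ (m i : ℕ) (hi : i < n), i + m = n - 1 → y ⟨i, hi⟩ = 0 := by
    intro m
    induction m with
    | zero => exact fun i hi e => hlast _ e
    | succ m ih =>
      intro i hi e
      rw [step i (by omega), ih (i + 1) (by omega) (by omega), mul_zero]
  ext i
  exact key (n - 1 - i) i i.2 (by omega)

theorem rpoly_add_smul (n : ℕ) (a b : Fin n → ℂ) (γ : ℂ) :
    rpoly n (fun k => b k + γ * a k) = rpoly n b - C γ * spoly n a := by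
  simp only [rpoly, spoly, Finset.mul_sum, C_add, C_mul, add_mul, Finset.sum_add_distrib,
    mul_assoc]
  ring

theorem eval_spoly (n : ℕ) (a : Fin n → ℂ) (z : ℂ) :
    (spoly n a).eval z = a ⬝ᵥ fun k : Fin n => z ^ (k : ℕ) := by
  simp [spoly, eval_finsetSum, dotProduct]

theorem eval_rpoly (n : ℕ) (c : Fin n → ℂ) (z : ℂ) :
    (rpoly n c).eval z = z ^ n - c ⬝ᵥ fun k : Fin n => z ^ (k : ℕ) := by
  simp [rpoly, eval_finsetSum, dotProduct]

theorem degree_spoly_lt (n : ℕ) (c : Fin n → ℂ) : (spoly n c).degree < n :=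
  degree_sum_fin_lt c

theorem monic_rpoly (n : ℕ) (c : Fin n → ℂ) : (rpoly n c).Monic :=
  monic_X_pow_sub (degree_spoly_lt n c)

theorem natDegree_rpoly (n : ℕ) (c : Fin n → ℂ) : (rpoly n c).natDegree = n := by
  refine natDegree_eq_of_degree_eq_some ?_
  have h := degree_spoly_lt n c
  rw [rpoly, degree_sub_eq_left_of_degree_lt] <;> rw [degree_X_pow]
  exact h

theorem companionMat_mulVec_pow {n : ℕ} {c : Fin n → ℂ} {z : ℂ}
    (hz : (rpoly n c).eval z = 0) :
    companionMat n c *ᵥ (fun k : Fin n => z ^ (k : ℕ)) = z • fun k : Fin n => z ^ (k : ℕ) := by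
  ext i
  rw [companionMat_mulVec, Pi.smul_apply, smul_eq_mul, ← pow_succ']
  split_ifs with hi
  · rfl
  · rw [eval_rpoly, sub_eq_zero] at hz
    rw [← hz, show (i : ℕ) + 1 = n by omega]

/-- If `H` is nonsingular and symmetric, intertwines the companion matrix `C` with `Cᵀ`, and
satisfies `H a = e_n`, then `spoly n a` does not vanish at the eigenvalues of `C`. -/
theorem eval_spoly_ne_zero {n : ℕ} (hn : 0 < n) {H : Matrix (Fin n) (Fin n) ℂ}
    (hsymm : Hᵀ = H) (hdet : IsUnit H.det) {a c : Fin n → ℂ}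
    (ha : H *ᵥ a = fun j : Fin n => if (j : ℕ) = n - 1 then 1 else 0)
    (hcomm : companionMat n c * H = H * (companionMat n c)ᵀ) {z : ℂ}
    (hz : (rpoly n c).eval z = 0) : (spoly n a).eval z ≠ 0 := by
  intro hs
  set v : Fin n → ℂ := fun k => z ^ (k : ℕ) with hv
  obtain ⟨y, hy⟩ : ∃ y, H *ᵥ y = v :=
    ⟨H⁻¹ *ᵥ v, by rw [mulVec_mulVec, mul_nonsing_inv H hdet, one_mulVec]⟩
  have hinj : Function.Injective H.mulVec :=
    mulVec_injective_iff_isUnit.2 ((isUnit_iff_isUnit_det H).2 hdet)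
  have hy0 : y = 0 := by
    refine eq_zero_of_transpose_companionMat_mulVec (c := c) (α := z) (hinj ?_) ?_
    · rw [mulVec_mulVec, ← hcomm, ← mulVec_mulVec, hy, mulVec_smul, hy]
      exact companionMat_mulVec_pow hz
    · intro i hi
      rw [eval_spoly, ← hv, ← hy, dotProduct_mulVec, ← mulVec_transpose, hsymm, ha] at hs
      rw [dotProduct, Finset.sum_eq_single i] at hs
      · simpa [hi] using hs
      · intro j _ hj
        have : (j : ℕ) ≠ n - 1 := fun e => hj (Fin.ext (e.trans hi.symm))
        simp [this]
      · simp
  have := congrFun hy ⟨0, hn⟩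
  simp [hy0, hv] at this

/-- A Hankel matrix intertwines `C` and `Cᵀ`, where `C` is the companion matrix whose last row `c`
solves `H c = (h_{n+1}, ..., h_{2n-1}, γ)ᵀ`. -/
theorem companionMat_mul_hankel {n : ℕ} {h : ℕ → ℂ} {H : Matrix (Fin n) (Fin n) ℂ}
    (hH : ∀ i j : Fin n, H i j = h ((i : ℕ) + (j : ℕ) + 1)) {c : Fin n → ℂ} {γ : ℂ}
    (hc : H *ᵥ c = fun j : Fin n => if (j : ℕ) = n - 1 then γ else h (n + 1 + (j : ℕ))) :
    companionMat n c * H = H * (companionMat n c)ᵀ := by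
  have hrow (j : Fin n) : c ⬝ᵥ H j = if (j : ℕ) = n - 1 then γ else h (n + 1 + (j : ℕ)) := by
    rw [dotProduct_comm]
    exact congrFun hc j
  have hcol (j : Fin n) : (fun k => H k j) = H j := by
    ext k
    rw [hH, hH, add_comm (k : ℕ)]
  ext i j
  rw [companionMat_mul_apply, mul_transpose_companionMat_apply, hcol, hrow, hrow]
  split_ifs <;> first | omega | rfl | (simp only [hH]; congr 1; omega)

/-- A polynomial with `natDegree` equal to `n` and only simple roots over `ℂ` has `n` distinct
roots. -/
theorem exists_injective_roots {p : ℂ[X]} {n : ℕ} (hdeg : p.natDegree = n) (hp : p ≠ 0)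
    (hsimple : ∀ z, p.eval z = 0 → p.derivative.eval z ≠ 0) :
    ∃ α : Fin n → ℂ, Function.Injective α ∧ ∀ i, p.eval (α i) = 0 := by
  have hnodup : p.roots.Nodup := by
    rw [Multiset.nodup_iff_count_le_one]
    intro z
    rw [count_roots]
    by_contra! hlt
    obtain ⟨h1, h2⟩ := (one_lt_rootMultiplicity_iff_isRoot hp).1 hlt
    exact hsimple z h1 h2
  have hcard : p.roots.toFinset.card = n := by
    rw [Multiset.toFinset_card_of_nodup hnodup, ← hdeg]
    exact (IsAlgClosed.splits p).natDegree_eq_card_roots.symm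
  let e := (p.roots.toFinset.equivFinOfCardEq hcard).symm
  refine ⟨fun i => e i, Subtype.val_injective.comp e.injective, fun i => ?_⟩
  exact ((mem_roots hp).1 (Multiset.mem_toFinset.1 (e i).2))

/-- Let `H` be an `n×n` nonsingular complex Hankel matrix, `a`, `b` the
solutions of `H a = e_n` and `H b = (h_{n+1},...,h_{2n-1},0)ᵀ`,
`S = {α | (r s' - r' s)(α) = 0 ∧ s(α) ≠ 0}` and `T = {r(α)/s(α) | α ∈ S}`.  Then for every
`γ ∉ T`, the companion matrix `C_γ` with last row `(b_0 + γ a_0, ..., b_{n-1} + γ a_{n-1})`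
has simple spectrum `{α_1, ..., α_n}` and `H = V D Vᵀ`, where `V = vander(α_1,...,α_n)` and
`D = diag(V⁻¹ H e_1)`. -/
theorem hankel_vandermonde_factorization
    (n : ℕ) (hn : 0 < n) (h : ℕ → ℂ)
    (H : Matrix (Fin n) (Fin n) ℂ)
    (hH : ∀ i j : Fin n, H i j = h ((i : ℕ) + (j : ℕ) + 1))
    (hdet : IsUnit H.det)
    (a b : Fin n → ℂ)
    (ha : H *ᵥ a = fun j : Fin n => if (j : ℕ) = n - 1 then 1 else 0)
    (hb : H *ᵥ b = fun j : Fin n => if (j : ℕ) = n - 1 then 0 else h (n + 1 + (j : ℕ)))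
    (γ : ℂ)
    (hγ : γ ∉ (fun z : ℂ => (rpoly n b).eval z / (spoly n a).eval z) ''
      {z : ℂ | (rpoly n b).eval z * ((spoly n a).derivative.eval z) -
          ((rpoly n b).derivative.eval z) * (spoly n a).eval z = 0 ∧
        (spoly n a).eval z ≠ 0}) :
    ∃ (α : Fin n → ℂ) (V D : Matrix (Fin n) (Fin n) ℂ),
      Function.Injective α ∧
      (companionMat n (fun k => b k + γ * a k)).charpoly =
        ∏ i : Fin n, (X - C (α i)) ∧
      V = Matrix.of (fun i j : Fin n => α j ^ (i : ℕ)) ∧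
      D = Matrix.diagonal (V⁻¹ *ᵥ fun i : Fin n => H i ⟨0, hn⟩) ∧
      H = V * D * Vᵀ := by
  set c : Fin n → ℂ := fun k => b k + γ * a k
  have hc : H *ᵥ c = fun j : Fin n => if (j : ℕ) = n - 1 then γ else h (n + 1 + (j : ℕ)) := by
    rw [show c = b + γ • a from rfl, mulVec_add, mulVec_smul, ha, hb]
    ext j
    by_cases hj : (j : ℕ) = n - 1 <;> simp [hj]
  have hsymm : Hᵀ = H := by
    ext i j
    rw [transpose_apply, hH, hH, add_comm (j : ℕ)]
  have hcomm := companionMat_mul_hankel hH hc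
  have hp : rpoly n c = rpoly n b - C γ * spoly n a := rpoly_add_smul n a b γ
  obtain ⟨α, hα, hroot⟩ := exists_injective_roots (natDegree_rpoly n c) (monic_rpoly n c).ne_zero
    (by
      intro z hz hz'
      have hs := eval_spoly_ne_zero hn hsymm hdet ha hcomm hz
      rw [hp, eval_sub, eval_mul, eval_C, sub_eq_zero] at hz
      rw [hp, derivative_sub, derivative_C_mul, eval_sub, eval_mul, eval_C, sub_eq_zero] at hz'
      refine hγ ⟨z, ⟨?_, hs⟩, ?_⟩
      · rw [hz, hz']
        ring
      · change _ / _ = _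
        rw [hz, mul_div_cancel_right₀ _ hs])
  set V : Matrix (Fin n) (Fin n) ℂ := Matrix.of fun i j => α j ^ (i : ℕ) with hV
  have hVu : IsUnit V.det := by
    have : V = (vandermonde α)ᵀ := rfl
    rw [this, det_transpose, isUnit_iff_ne_zero]
    exact det_vandermonde_ne_zero_iff.2 hα
  have hCV : companionMat n c * V = V * diagonal α := by
    ext i j
    rw [mul_diagonal]
    refine (congrFun (companionMat_mulVec_pow (hroot j)) i).trans ?_
    simp [hV, mul_comm]
  refine ⟨α, V, _, hα, ?_, rfl, rfl, ?_⟩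
  · have hC : companionMat n c = V * diagonal α * V⁻¹ := by
      rw [← hCV, Matrix.mul_assoc, mul_nonsing_inv V hVu, Matrix.mul_one]
    rw [hC, Matrix.mul_assoc, charpoly_mul_comm, Matrix.mul_assoc, nonsing_inv_mul V hVu,
      Matrix.mul_one, charpoly_diagonal]
  · set d := V⁻¹ *ᵥ fun i : Fin n => H i ⟨0, hn⟩ with hd
    refine eq_of_companionMat_mul_eq_mul_transpose hn hcomm ?_ ?_
    · have hCV' := congrArg transpose hCV
      rw [transpose_mul, transpose_mul, diagonal_transpose] at hCV'
      have hd' : diagonal α * diagonal d = diagonal d * diagonal α := by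
        simp only [diagonal_mul_diagonal, mul_comm]
      calc companionMat n c * (V * diagonal d * Vᵀ)
          = companionMat n c * V * diagonal d * Vᵀ := by simp only [Matrix.mul_assoc]
        _ = V * (diagonal α * diagonal d) * Vᵀ := by rw [hCV, Matrix.mul_assoc V]
        _ = V * diagonal d * (diagonal α * Vᵀ) := by rw [hd']; simp only [Matrix.mul_assoc]
        _ = V * diagonal d * Vᵀ * (companionMat n c)ᵀ := by
          rw [← hCV', ← Matrix.mul_assoc]
    · intro i
      have hVd : V *ᵥ d = fun i : Fin n => H i ⟨0, hn⟩ := by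
        rw [hd, mulVec_mulVec, mul_nonsing_inv V hVu, one_mulVec]
      rw [← congrFun hVd i]
      rw [Matrix.mul_apply]
      simp only [mul_diagonal]
      simp [mulVec, dotProduct, hV]
end

section
/- Let n = 2m - 1 with m an integer greater than 1. Let B(s) = (b_1(s), b_2(s))^T be the Bézier curve of degree n-1 with control points Q_0 = (x_0, y_0), ..., Q_{n-1} = (x_{n-1}, y_{n-1}), and let H_x and H_y be the m×m Hankel matrices with (H_x)_{ij} = x_{i+j-2} and (H_y)_{ij} = y_{i+j-2}. If H_x and H_y are nonsingular, then there exist complex numbers d_1, ..., d_m, t_1, ..., t_m, d̂_1, ..., d̂_m, t̂_1, ..., t̂_m such that for all s ∈ [0,1], b_1(s) = Σ_{i=1}^m d_i (1 - s + s·t_i)^{n-1} and b_2(s) = Σ_{i=1}^m d̂_i (1 - s + s·t̂_i)^{n-1}. -/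
open Matrix

section

open Polynomial

/-- If the form `(f, g) ↦ L (f * g)` is nondegenerate on polynomials of degree `< m`, then it
represents every linear functional there. -/
theorem exists_mul_eq_of_nondegenerate {K : Type*} [Field K] {m : ℕ} (L : K[X] →ₗ[K] K)
    (hL : ∀ f ∈ degreeLT K m, (∀ g ∈ degreeLT K m, L (f * g) = 0) → f = 0)
    (M : K[X] →ₗ[K] K) :
    ∃ f ∈ degreeLT K m, ∀ g ∈ degreeLT K m, L (f * g) = M g := by
  let V := degreeLT K m
  have : FiniteDimensional K V := (degreeLTEquiv K m).symm.finiteDimensional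
  let φ : V →ₗ[K] Module.Dual K V := ((LinearMap.mul K K[X]).compr₂ L).domRestrict₁₂ V V
  have hφ : Function.Injective φ := by
    rw [← LinearMap.ker_eq_bot, LinearMap.ker_eq_bot']
    intro f hf
    exact Subtype.ext (hL f f.2 fun g hg => LinearMap.congr_fun hf ⟨g, hg⟩)
  obtain ⟨f, hf⟩ := (LinearMap.injective_iff_surjective_of_finrank_eq_finrank
    Subspace.dual_finrank_eq.symm).1 hφ (M.comp V.subtype)
  exact ⟨f, f.2, fun g hg => LinearMap.congr_fun hf ⟨g, hg⟩⟩

/-- Quasi-orthogonal polynomials of degrees `k + 1` and at most `k` for a nondegenerate functional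
are coprime. -/
theorem isCoprime_of_orthogonal {K : Type*} [Field K] [IsAlgClosed K] {k : ℕ} (L : K[X] →ₗ[K] K)
    (hL : ∀ f ∈ degreeLT K (k + 1), (∀ g ∈ degreeLT K (k + 1), L (f * g) = 0) → f = 0)
    {P Q : K[X]} (hP : P.Monic) (hPdeg : P.natDegree = k + 1)
    (hQ : Q ≠ 0) (hQdeg : Q.natDegree ≤ k)
    (hPL : ∀ g : K[X], g.degree < k → L (P * g) = 0)
    (hQL : ∀ g : K[X], g.degree < k → L (Q * g) = 0) :
    IsCoprime P Q := by
  rw [isCoprime_iff_aeval_ne_zero_of_isAlgClosed K K]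
  by_contra! h
  obtain ⟨a, haP, haQ⟩ := h
  rw [coe_aeval_eq_eval] at haP haQ
  obtain ⟨P', rfl⟩ := dvd_iff_isRoot.2 haP
  obtain ⟨Q', rfl⟩ := dvd_iff_isRoot.2 haQ
  have hm := monic_X_sub_C a
  have hP' : P'.Monic := hm.of_mul_monic_left hP
  have hQ' : Q' ≠ 0 := right_ne_zero_of_mul hQ
  rw [hm.natDegree_mul hP', natDegree_X_sub_C] at hPdeg
  rw [hm.natDegree_mul' hQ', natDegree_X_sub_C] at hQdeg
  have key : ∀ R : K[X], (∀ g : K[X], g.degree < k → L ((X - C a) * R * g) = 0) →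
      ∀ g ∈ degreeLT K (k + 1), L (R * g) = g.eval a * L R := by
    intro R hR g hg
    rw [mem_degreeLT] at hg
    have hdeg : (g /ₘ (X - C a)).degree < k := by
      by_cases h0 : g /ₘ (X - C a) = 0
      · simp [h0]
      rw [← natDegree_lt_iff_degree_lt h0, natDegree_divByMonic _ hm, natDegree_X_sub_C]
      have hgd : (X - C a).degree ≤ g.degree := by
        by_contra! h
        exact h0 ((divByMonic_eq_zero_iff hm).2 h)
      have hg0 : g ≠ 0 := by rintro rfl; simp at h0
      have h1 := (natDegree_lt_iff_degree_lt hg0).2 hg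
      have h2 := natDegree_le_natDegree hgd
      rw [natDegree_X_sub_C] at h2
      omega
    conv_lhs => rw [← modByMonic_add_div g (X - C a), modByMonic_X_sub_C_eq_C_eval]
    rw [mul_add, map_add, show R * ((X - C a) * (g /ₘ (X - C a))) =
      (X - C a) * R * (g /ₘ (X - C a)) by ring, hR _ hdeg, mul_comm, ← smul_eq_C_mul, map_smul,
      smul_eq_mul, add_zero]
  have hQmem : Q' ∈ degreeLT K (k + 1) :=
    mem_degreeLT.2 ((natDegree_lt_iff_degree_lt hQ').1 (by omega))
  have hPmem : P' ∈ degreeLT K (k + 1) :=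
    mem_degreeLT.2 ((natDegree_lt_iff_degree_lt hP'.ne_zero).1 (by omega))
  have hf := hL (L Q' • P' - L P' • Q')
    (Submodule.sub_mem _ (Submodule.smul_mem _ _ hPmem) (Submodule.smul_mem _ _ hQmem)) (by
      intro g hg
      rw [sub_mul, smul_mul_assoc, smul_mul_assoc, map_sub, map_smul, map_smul,
        key P' hPL g hg, key Q' hQL g hg, smul_eq_mul, smul_eq_mul]
      ring)
  have hLQ : L Q' = 0 := by
    have := congrArg (coeff · k) hf
    have hPk : P'.coeff k = 1 := by
      have := hP'.coeff_natDegree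
      rwa [show P'.natDegree = k by omega] at this
    simpa [hPk, coeff_eq_zero_of_natDegree_lt (show Q'.natDegree < k by omega)] using this
  exact hQ' (hL Q' hQmem fun g hg => by rw [key Q' hQL g hg, hLQ, mul_zero])

/-- A pencil spanned by coprime polynomials contains a separable member. -/
theorem exists_sub_C_mul_separable {K : Type*} [Field K] [IsAlgClosed K] [CharZero K]
    {P Q : K[X]} (h : IsCoprime P Q) (hP : 0 < P.natDegree) :
    ∃ c : K, (P - C c * Q).Separable := by
  classical
  have hW : wronskian P Q ≠ 0 := by
    rw [Ne, h.wronskian_eq_zero_iff]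
    rintro ⟨h0, -⟩
    exact hP.ne' (derivative_eq_zero.1 h0)
  obtain ⟨c, hc⟩ := Infinite.exists_notMem_finset
    ((wronskian P Q).roots.toFinset.image fun t => P.eval t / Q.eval t)
  refine ⟨c, ?_⟩
  rw [Separable, isCoprime_iff_aeval_ne_zero_of_isAlgClosed K K]
  by_contra! hcon
  obtain ⟨a, h1, h2⟩ := hcon
  simp only [coe_aeval_eq_eval, eval_sub, eval_mul, eval_C, derivative_sub, derivative_C_mul,
    sub_eq_zero] at h1 h2
  have hQa : Q.eval a ≠ 0 := by
    intro h0
    have := (isCoprime_iff_aeval_ne_zero_of_isAlgClosed K K P Q).1 h a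
    simp [h0, h1] at this
  refine hc (Finset.mem_image.2 ⟨a, ?_, ?_⟩)
  · rw [Multiset.mem_toFinset, mem_roots hW, IsRoot.def]
    simp only [wronskian, eval_sub, eval_mul, h1, h2]
    ring
  · rw [h1]
    field_simp

/-- Over an algebraically closed field, a nondegenerate functional has a `(k + 1)`-node quadrature
rule that is exact up to degree `2 * k`. -/
theorem exists_quadrature {K : Type*} [Field K] [IsAlgClosed K] [CharZero K] {k : ℕ}
    (L : K[X] →ₗ[K] K)
    (hL : ∀ f ∈ degreeLT K (k + 1), (∀ g ∈ degreeLT K (k + 1), L (f * g) = 0) → f = 0) :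
    ∃ d t : Fin (k + 1) → K, ∀ f : K[X], f.natDegree ≤ 2 * k → L f = ∑ i, d i * f.eval (t i) := by
  obtain ⟨A, hA, hAL⟩ := exists_mul_eq_of_nondegenerate L hL
    (L.comp (LinearMap.mulLeft K (X ^ (k + 1))))
  obtain ⟨Q, hQ, hQL⟩ := exists_mul_eq_of_nondegenerate L hL (lcoeff K k)
  rw [mem_degreeLT] at hA hQ
  have hmem : ∀ g : K[X], g.degree < k → g ∈ degreeLT K (k + 1) := fun g hg =>
    mem_degreeLT.2 (hg.trans (by exact_mod_cast Nat.lt_succ_self k))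
  have hPL : ∀ g : K[X], g.degree < k → L ((X ^ (k + 1) - A) * g) = 0 := fun g hg => by
    rw [sub_mul, map_sub, hAL g (hmem g hg)]
    simp
  have hQL' : ∀ g : K[X], g.degree < k → L (Q * g) = 0 := fun g hg => by
    rw [hQL g (hmem g hg), lcoeff_apply, coeff_eq_zero_of_degree_lt hg]
  have hQ0 : Q ≠ 0 := by
    rintro rfl
    have := hQL (X ^ k) (mem_degreeLT.2 (by rw [degree_X_pow]; exact_mod_cast Nat.lt_succ_self k))
    simp at this
  have hmonic : ∀ R : K[X], R.degree < (k + 1 : ℕ) →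
      (X ^ (k + 1) - R).Monic ∧ (X ^ (k + 1) - R).natDegree = k + 1 := fun R hR =>
    ⟨by
      rw [sub_eq_add_neg]
      exact monic_X_pow_add (by rwa [degree_neg]),
      natDegree_eq_of_degree_eq_some (by
        rw [degree_sub_eq_left_of_degree_lt (by rwa [degree_X_pow]), degree_X_pow])⟩
  have hcop : IsCoprime (X ^ (k + 1) - A) Q :=
    isCoprime_of_orthogonal L hL (hmonic A hA).1 (hmonic A hA).2 hQ0
      (Nat.lt_succ_iff.1 ((natDegree_lt_iff_degree_lt hQ0).2 hQ)) hPL hQL'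
  obtain ⟨c, hc⟩ := exists_sub_C_mul_separable hcop (by rw [(hmonic A hA).2]; omega)
  set p := X ^ (k + 1) - A - C c * Q with hp
  have hp' : p.Monic ∧ p.natDegree = k + 1 := by
    rw [hp, sub_sub]
    refine hmonic _ (mem_degreeLT.1 (Submodule.add_mem _ (mem_degreeLT.2 hA) ?_))
    rw [← smul_eq_C_mul]
    exact Submodule.smul_mem _ _ (mem_degreeLT.2 hQ)
  have hpL : ∀ g : K[X], g.degree < k → L (p * g) = 0 := fun g hg => by
    rw [hp, sub_mul, map_sub, hPL g hg, ← smul_eq_C_mul, smul_mul_assoc, map_smul, hQL' g hg]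
    simp
  classical
  have hcard : p.roots.toFinset.card = k + 1 := by
    rw [Multiset.toFinset_card_of_nodup (nodup_roots hc), ← hp'.2]
    exact splits_iff_card_roots.1 (IsAlgClosed.splits p)
  let e := (Finset.equivFinOfCardEq hcard).symm
  let t : Fin (k + 1) → K := fun i => (e i : K)
  have htinj : Function.Injective t := Subtype.val_injective.comp e.injective
  have htroot : ∀ i, p.eval (t i) = 0 := fun i =>
    (mem_roots'.1 (Multiset.mem_toFinset.1 (e i).2)).2
  refine ⟨fun i => L (Lagrange.basis Finset.univ t i), t, fun f hf => ?_⟩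
  have hr : f %ₘ p = ∑ i, C (f.eval (t i)) * Lagrange.basis Finset.univ t i := by
    rw [← Lagrange.interpolate_apply]
    refine Lagrange.eq_interpolate_of_eval_eq _ htinj.injOn ?_ fun i _ => ?_
    · refine (degree_modByMonic_lt f hp'.1).trans_le ?_
      rw [degree_eq_natDegree hp'.1.ne_zero, hp'.2]
      simp
    · conv_rhs => rw [← modByMonic_add_div f p]
      simp [htroot]
  have hq : (f /ₘ p).degree < k := by
    by_cases h0 : f /ₘ p = 0
    · simp [h0]
    rw [← natDegree_lt_iff_degree_lt h0, natDegree_divByMonic _ hp'.1, hp'.2]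
    have hle : p.degree ≤ f.degree := by
      by_contra! h
      exact h0 ((divByMonic_eq_zero_iff hp'.1).2 h)
    have := natDegree_le_natDegree hle
    omega
  conv_lhs => rw [← modByMonic_add_div f p]
  rw [map_add, hpL _ hq, add_zero, hr, map_sum]
  refine Finset.sum_congr rfl fun i _ => ?_
  rw [← smul_eq_C_mul, map_smul, smul_eq_mul, mul_comm]

/-- A sequence with a nonsingular Hankel matrix of size `k + 1` is a sum of `k + 1` geometric
sequences up to index `2 * k`. -/
theorem exists_eq_sum_mul_pow_of_hankel {K : Type*} [Field K] [IsAlgClosed K] [CharZero K]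
    {k : ℕ} (x : ℕ → K)
    (hx : IsUnit (Matrix.of fun i j : Fin (k + 1) => x (i + j)).det) :
    ∃ d t : Fin (k + 1) → K, ∀ l ≤ 2 * k, x l = ∑ i, d i * t i ^ l := by
  let L : K[X] →ₗ[K] K := Polynomial.lsum fun l => x l • LinearMap.id
  have hLX : ∀ l, L (X ^ l) = x l := fun l => by
    simp [L, Polynomial.lsum_apply, ← monomial_one_right_eq_X_pow, sum_monomial_index]
  obtain ⟨d, t, h⟩ := exists_quadrature (k := k) L (by
    intro f hf hfg
    rw [mem_degreeLT] at hf
    have hfsum : f = ∑ j : Fin (k + 1), f.coeff j • X ^ (j : ℕ) := by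
      rw [Fin.sum_univ_eq_sum_range (fun j => f.coeff j • (X : K[X]) ^ j)]
      conv_lhs => rw [as_sum_range' f (k + 1) (by
        by_cases h0 : f = 0
        · simp [h0]
        · exact (natDegree_lt_iff_degree_lt h0).2 hf)]
      simp [smul_X_eq_monomial]
    have hz : (fun j : Fin (k + 1) => f.coeff j) = 0 := by
      refine Matrix.eq_zero_of_mulVec_eq_zero hx.ne_zero (funext fun i => ?_)
      have := hfg (X ^ (i : ℕ)) (mem_degreeLT.2 (by
        rw [degree_X_pow]; exact_mod_cast i.2))
      rw [hfsum, Finset.sum_mul, map_sum] at this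
      simp only [smul_mul_assoc, map_smul, ← pow_add, hLX] at this
      rw [Pi.zero_apply, ← this]
      simp only [Matrix.mulVec, dotProduct, Matrix.of_apply]
      exact Finset.sum_congr rfl fun j _ => by
        rw [smul_eq_mul, mul_comm, add_comm (i : ℕ)]
    rw [hfsum]
    exact Finset.sum_eq_zero fun j _ => by rw [show f.coeff j = 0 from congrFun hz j, zero_smul])
  exact ⟨d, t, fun l hl => by simpa [hLX] using h (X ^ l) (by simpa using hl)⟩

end

/-- A Bézier coordinate function with a nonsingular Hankel matrix is a sum of `m` powers of linear
forms. -/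
theorem exists_bernstein_sum_eq {m n : ℕ} (hm : 0 < m) (hn : n = 2 * m - 1) (x : Fin n → ℝ)
    (hx : IsUnit (Matrix.of fun i j : Fin m =>
      x ⟨(i : ℕ) + (j : ℕ), by omega⟩ : Matrix (Fin m) (Fin m) ℝ).det) :
    ∃ d t : Fin m → ℂ, ∀ s : ℝ,
      ((∑ i : Fin n, ((n - 1).choose (i : ℕ) : ℝ) * s ^ (i : ℕ) *
          (1 - s) ^ (n - 1 - (i : ℕ)) * x i : ℝ) : ℂ) =
        ∑ i : Fin m, d i * (1 - (s : ℂ) + (s : ℂ) * t i) ^ (n - 1) := by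
  obtain ⟨k, rfl⟩ := Nat.exists_eq_succ_of_ne_zero hm.ne'
  obtain rfl : n = 2 * k + 1 := by omega
  let x' : ℕ → ℂ := fun l => if h : l < 2 * k + 1 then (x ⟨l, h⟩ : ℂ) else 0
  have hx' : ∀ i : Fin (2 * k + 1), x' i = x i := fun i => dif_pos i.2
  obtain ⟨d, t, h⟩ := exists_eq_sum_mul_pow_of_hankel (k := k) x' (by
    convert hx.map Complex.ofRealHom
    rw [RingHom.map_det]
    congr 1
    ext i j
    exact hx' ⟨i + j, by omega⟩)
  refine ⟨d, t, fun s => ?_⟩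
  simp only [add_tsub_cancel_right, Complex.ofReal_sum, Complex.ofReal_mul, Complex.ofReal_pow,
    Complex.ofReal_sub, Complex.ofReal_one, Complex.ofReal_natCast]
  calc _ = ∑ l : Fin (2 * k + 1), ∑ i, d i * ((s * t i) ^ (l : ℕ) *
        (1 - (s : ℂ)) ^ (2 * k - (l : ℕ)) * ((2 * k).choose l : ℂ)) := by
        refine Finset.sum_congr rfl fun l _ => ?_
        rw [← hx', h l (by omega), Finset.mul_sum]
        exact Finset.sum_congr rfl fun i _ => by ring
    _ = _ := by
        rw [Finset.sum_comm]
        refine Finset.sum_congr rfl fun i _ => ?_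
        rw [← Finset.mul_sum, add_comm (1 - (s : ℂ)), add_pow, Fin.sum_univ_eq_sum_range (fun l =>
          ((s : ℂ) * t i) ^ l * (1 - (s : ℂ)) ^ (2 * k - l) * ((2 * k).choose l : ℂ))]

/-- Let `n = 2m - 1`, `m > 1`, and let `B(s) = (b₁(s), b₂(s))ᵀ` be the Bézier
curve of degree `n-1` with control points `(x_i, y_i)`.  If the `m×m` Hankel matrices
`(H_x)_{ij} = x_{i+j-2}` and `(H_y)_{ij} = y_{i+j-2}` are nonsingular, then there exist complex
numbers `d_i, t_i, d̂_i, t̂_i` (`i = 1, ..., m`) such that for all `s ∈ [0,1]`,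
`b₁(s) = ∑ d_i (1 - s + s t_i)^(n-1)` and `b₂(s) = ∑ d̂_i (1 - s + s t̂_i)^(n-1)`. -/
theorem bezier_exponential_representation
    (m : ℕ) (hm : 1 < m) (n : ℕ) (hn : n = 2 * m - 1)
    (x y : Fin n → ℝ)
    (hx : IsUnit (Matrix.of fun i j : Fin m =>
      x ⟨(i : ℕ) + (j : ℕ), by omega⟩ : Matrix (Fin m) (Fin m) ℝ).det)
    (hy : IsUnit (Matrix.of fun i j : Fin m =>
      y ⟨(i : ℕ) + (j : ℕ), by omega⟩ : Matrix (Fin m) (Fin m) ℝ).det) :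
    ∃ d t dh th : Fin m → ℂ, ∀ s : ℝ, s ∈ Set.Icc (0 : ℝ) 1 →
      ((∑ i : Fin n, ((n - 1).choose (i : ℕ) : ℝ) * s ^ (i : ℕ) *
          (1 - s) ^ (n - 1 - (i : ℕ)) * x i : ℝ) : ℂ) =
        ∑ i : Fin m, d i * (1 - (s : ℂ) + (s : ℂ) * t i) ^ (n - 1) ∧
      ((∑ i : Fin n, ((n - 1).choose (i : ℕ) : ℝ) * s ^ (i : ℕ) *
          (1 - s) ^ (n - 1 - (i : ℕ)) * y i : ℝ) : ℂ) =
        ∑ i : Fin m, dh i * (1 - (s : ℂ) + (s : ℂ) * th i) ^ (n - 1) := by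
  obtain ⟨d, t, h⟩ := exists_bernstein_sum_eq (by omega) hn x hx
  obtain ⟨dh, th, hh⟩ := exists_bernstein_sum_eq (by omega) hn y hy
  exact ⟨d, t, dh, th, fun s _ => ⟨h s, hh s⟩⟩
end

section
/- Let B_n^e(s) be the n×n Bernstein matrix for s ∈ [0,1]. For 1 ≤ k ≤ n-1, define the n×n matrix E_k^e(s) = e_1 e_1^T + ... + e_k e_k^T + e_{k+1}[(1-s)e_k + s e_{k+1}]^T + ... + e_n[(1-s)e_{n-1} + s e_n]^T (i.e., rows 1 through k are the standard basis rows, and for i > k row i equals (1-s)e_{i-1}^T + s e_i^T). Then B_n^e(s) = E_{n-1}^e(s) · E_{n-2}^e(s) · ... · E_1^e(s). -/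
open Matrix

/-- The `n×n` bidiagonal factor `E_k^e(s)`: rows `1, ..., k` (1-based) are the standard basis
rows, and for `i > k` row `i` equals `(1-s) e_{i-1}ᵀ + s e_iᵀ`. -/
def bidiagE (n : ℕ) (s : ℝ) (k : ℕ) : Matrix (Fin n) (Fin n) ℝ :=
  Matrix.of fun i j : Fin n =>
    if (i : ℕ) < k then (if i = j then 1 else 0)
    else if (j : ℕ) + 1 = (i : ℕ) then 1 - s
    else if j = i then s else 0

open Polynomial in
/-- The coefficients of `((1 - s) + s X) ^ i` are the Bernstein weights. -/
lemma coeff_linear_pow (s : ℝ) (i j : ℕ) :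
    ((C s * X + C (1 - s)) ^ i).coeff j =
      if j ≤ i then (i.choose j : ℝ) * s ^ j * (1 - s) ^ (i - j) else 0 := by
  have h (m : ℕ) : ((C s * X) ^ m * C (1 - s) ^ (i - m) * ((i.choose m : ℕ) : ℝ[X])).coeff j =
      if j = m then (i.choose m : ℝ) * s ^ m * (1 - s) ^ (i - m) else 0 := by
    have : (C s * X) ^ m * C (1 - s) ^ (i - m) * ((i.choose m : ℕ) : ℝ[X]) =
        C ((i.choose m : ℝ) * s ^ m * (1 - s) ^ (i - m)) * X ^ m := by
      simp only [C_mul, C_pow, map_natCast]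
      ring
    rw [this, coeff_C_mul_X_pow]
  rw [add_pow, finsetSum_coeff, Finset.sum_congr rfl fun m _ => h m, Finset.sum_ite_eq]
  simp

/-- Left multiplication by `bidiagE n s k` fixes the rows of index below `k`. -/
lemma bidiagE_mul_apply_of_lt {n : ℕ} (s : ℝ) {k : ℕ} (M : Matrix (Fin n) (Fin n) ℝ)
    {i : Fin n} (hi : (i : ℕ) < k) (j : Fin n) : (bidiagE n s k * M) i j = M i j := by
  simp [Matrix.mul_apply, bidiagE, hi]

/-- Left multiplication by `bidiagE n s k` combines each row of index at least `k` with its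
predecessor. -/
lemma bidiagE_mul_apply_of_le {n : ℕ} (s : ℝ) {k : ℕ} (M : Matrix (Fin n) (Fin n) ℝ)
    {i i' : Fin n} (hi : k ≤ (i : ℕ)) (hi' : (i' : ℕ) + 1 = i) (j : Fin n) :
    (bidiagE n s k * M) i j = (1 - s) * M i' j + s * M i j := by
  have hne : i' ≠ i := by
    rintro rfl
    omega
  rw [Matrix.mul_apply, Fintype.sum_eq_add i' i hne]
  · simp [bidiagE, hi.not_gt, hi']
  · rintro l ⟨h₁, h₂⟩
    have : (l : ℕ) + 1 ≠ i := fun h => h₁ (Fin.ext (by omega))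
    simp [bidiagE, hi.not_gt, this, h₂]

open Polynomial in
/-- Row `i` of the partial product `E_m ⋯ E_1` has generating polynomial
`X ^ (i - m) * ((1 - s) + s X) ^ min i m`. -/
lemma prod_bidiagE_apply (n : ℕ) (s : ℝ) (m : ℕ) (i j : Fin n) :
    ((List.range m).reverse.map fun k => bidiagE n s (k + 1)).prod i j =
      (X ^ ((i : ℕ) - m) * (C s * X + C (1 - s)) ^ min (i : ℕ) m : ℝ[X]).coeff j := by
  induction m generalizing i with
  | zero => simp [Matrix.one_apply, coeff_X_pow, Fin.ext_iff, eq_comm]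
  | succ m ih =>
    rw [List.range_succ, List.reverse_append, List.reverse_singleton, List.singleton_append,
      List.map_cons, List.prod_cons]
    rcases lt_or_ge (i : ℕ) (m + 1) with hi | hi
    · rw [bidiagE_mul_apply_of_lt s _ hi, ih, min_eq_left (by omega), min_eq_left (by omega),
        Nat.sub_eq_zero_of_le (by omega), Nat.sub_eq_zero_of_le (by omega)]
    · obtain ⟨d, hd⟩ := Nat.exists_eq_add_of_le hi
      rw [bidiagE_mul_apply_of_le s _ (i' := ⟨m + d, by omega⟩) hi (by simp only; omega), ih, ih,
        ← coeff_C_mul, ← coeff_C_mul, ← coeff_add]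
      simp only [hd]
      rw [min_eq_right (by omega), min_eq_right (by omega), min_eq_right (by omega),
        show m + d - m = d by omega, show m + 1 + d - m = d + 1 by omega,
        show m + 1 + d - (m + 1) = d by omega]
      congr 1
      ring

/-- For `s ∈ [0,1]`,
`B_n^e(s) = E_{n-1}^e(s) · E_{n-2}^e(s) · ... · E_1^e(s)`. -/
theorem bernstein_eq_prod_bidiagonal (n : ℕ) (s : ℝ) (hs : s ∈ Set.Icc (0 : ℝ) 1) :
    bernsteinMat n s =
      (((List.range (n - 1)).reverse.map fun k => bidiagE n s (k + 1))).prod := by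
  ext i j
  rw [prod_bidiagE_apply, min_eq_left (by omega), Nat.sub_eq_zero_of_le (by omega), pow_zero,
    one_mul, coeff_linear_pow]
  rfl
end

section
/- Let m be a positive integer, let C_m be the m×m reciprocal matrix, i.e., the Hankel matrix with (C_m)_{ij} = 1 if i + j = m + 1 and 0 otherwise, and let w = e^{2πi/m}. Then for every s ∈ [0,1], with n = 2m-1, e_m^T B_m^e(s) C_m (B_m^e(s))^T e_m = (1/m) Σ_{j=1}^{m} w^{j-1} (1 - s + s·w^{j-1})^{n-1}. -/
open Matrix

/-- The `m×m` Bernstein matrix `B_m^e(s)` over `ℂ` (for real `s`). -/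
def bernsteinMatC (m : ℕ) (s : ℝ) : Matrix (Fin m) (Fin m) ℂ :=
  Matrix.of fun i j : Fin m =>
    if (j : ℕ) ≤ (i : ℕ) then
      ((i : ℕ).choose (j : ℕ) : ℂ) * (s : ℂ) ^ (j : ℕ) * (1 - (s : ℂ)) ^ ((i : ℕ) - (j : ℕ))
    else 0

/-- Orthogonality of the powers of a primitive root of unity. -/
theorem IsPrimitiveRoot.sum_fin_pow_mul {R : Type*} [CommRing R] [IsDomain R] {ζ : R} {m : ℕ}
    (hζ : IsPrimitiveRoot ζ m) (k : ℕ) :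
    ∑ j : Fin m, (ζ ^ (j : ℕ)) ^ k = if m ∣ k then (m : R) else 0 := by
  have hcomm : ∀ j : ℕ, (ζ ^ j) ^ k = (ζ ^ k) ^ j := fun j => by
    rw [← pow_mul, ← pow_mul, mul_comm]
  simp only [hcomm]
  rw [Fin.sum_univ_eq_sum_range (fun j => (ζ ^ k) ^ j) m]
  split_ifs with h
  · simp [(hζ.pow_eq_one_iff_dvd k).2 h]
  · have hne : ζ ^ k - 1 ≠ 0 := fun h0 => h ((hζ.pow_eq_one_iff_dvd k).1 (sub_eq_zero.1 h0))
    refine (mul_eq_zero.1 ?_).resolve_right hne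
    rw [geom_sum_mul, ← hcomm, hζ.pow_eq_one, one_pow, sub_self]

/-- The generating function of the last row of the Bernstein matrix. -/
theorem sum_bernsteinMatC_last_mul_pow (N : ℕ) (s : ℝ) (x : ℂ) :
    ∑ k : Fin (N + 1), bernsteinMatC (N + 1) s (Fin.last N) k * x ^ (k : ℕ) =
      (1 - (s : ℂ) + (s : ℂ) * x) ^ N := by
  rw [add_comm (1 - (s : ℂ)), add_pow, ← Fin.sum_univ_eq_sum_range
    (fun k => ((s : ℂ) * x) ^ k * (1 - (s : ℂ)) ^ (N - k) * (N.choose k : ℂ)) (N + 1)]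
  refine Finset.sum_congr rfl fun k _ => ?_
  simp only [bernsteinMatC, Matrix.of_apply, Fin.val_last, if_pos (Nat.lt_succ_iff.1 k.2)]
  ring

/-- Let `C_m` be the `m×m` reciprocal (skew-identity) matrix and
`w = e^{2πi/m}`.  Then for every `s ∈ [0,1]`, with `n = 2m - 1`,
`e_mᵀ B_m^e(s) C_m (B_m^e(s))ᵀ e_m = (1/m) ∑_{j=1}^m w^{j-1} (1 - s + s w^{j-1})^{n-1}`. -/
theorem bernstein_reciprocal_form
    (m : ℕ) (hm : 0 < m) (n : ℕ) (hn : n = 2 * m - 1)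
    (s : ℝ) (hs : s ∈ Set.Icc (0 : ℝ) 1) :
    (bernsteinMatC m s *
      (Matrix.of fun i j : Fin m => if (i : ℕ) + (j : ℕ) = m - 1 then (1 : ℂ) else 0) *
      (bernsteinMatC m s)ᵀ) ⟨m - 1, by omega⟩ ⟨m - 1, by omega⟩ =
    (1 / (m : ℂ)) * ∑ j : Fin m,
      Complex.exp (2 * Real.pi * Complex.I / m) ^ (j : ℕ) *
        (1 - (s : ℂ) + (s : ℂ) * Complex.exp (2 * Real.pi * Complex.I / m) ^ (j : ℕ)) ^ (n - 1) := by
  obtain ⟨N, rfl⟩ : ∃ N, m = N + 1 := ⟨m - 1, by omega⟩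
  have hw := Complex.isPrimitiveRoot_exp (N + 1) N.succ_ne_zero
  set w := Complex.exp (2 * Real.pi * Complex.I / ((N + 1 : ℕ) : ℂ))
  have hn' : n - 1 = N + N := by omega
  have hlast : (⟨N + 1 - 1, by omega⟩ : Fin (N + 1)) = Fin.last N := rfl
  have hm0 : ((N + 1 : ℕ) : ℂ) ≠ 0 := Nat.cast_ne_zero.2 N.succ_ne_zero
  rw [hlast, hn', one_div, eq_inv_mul_iff_mul_eq₀ hm0]
  set b := bernsteinMatC (N + 1) s (Fin.last N) with hb
  have hdvd : ∀ k l : Fin (N + 1), N + 1 ∣ (k : ℕ) + l + 1 ↔ (k : ℕ) + l = N := by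
    intro k l
    constructor
    · rintro ⟨c, hc⟩
      have hk := k.2
      have hl := l.2
      have hc2 : c < 2 := by
        by_contra! h
        have := Nat.mul_le_mul_left (N + 1) h
        omega
      interval_cases c <;> omega
    · intro h
      rw [h]
  calc _ = ∑ l, ∑ k, b k * b l * (if N + 1 ∣ (k : ℕ) + l + 1 then ((N + 1 : ℕ) : ℂ) else 0) := by
        simp only [Matrix.mul_apply, Matrix.transpose_apply, Matrix.of_apply, ← hb,
          Finset.mul_sum, Finset.sum_mul, hdvd, Nat.add_sub_cancel]
        refine Finset.sum_congr rfl fun l _ => Finset.sum_congr rfl fun k _ => ?_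
        split_ifs <;> ring
    _ = ∑ l, ∑ k, ∑ j : Fin (N + 1), b k * b l * (w ^ (j : ℕ)) ^ ((k : ℕ) + l + 1) := by
        simp only [← hw.sum_fin_pow_mul, Finset.mul_sum]
    _ = ∑ j : Fin (N + 1), ∑ l, ∑ k, b k * b l * (w ^ (j : ℕ)) ^ ((k : ℕ) + l + 1) := by
        exact (Finset.sum_congr rfl fun l _ => Finset.sum_comm).trans Finset.sum_comm
    _ = _ := by
        refine Finset.sum_congr rfl fun j _ => ?_
        rw [pow_add, ← sum_bernsteinMatC_last_mul_pow, Finset.sum_mul_sum, Finset.mul_sum,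
          Finset.sum_comm]
        refine Finset.sum_congr rfl fun k _ => ?_
        rw [Finset.mul_sum]
        refine Finset.sum_congr rfl fun l _ => ?_
        ring
end
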